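/- Let S ∈ TOEC be orthogonally homogeneous and satisfy the convex open set condition. Then I_S = Z[p_S]; in particular, I_S is a principal ideal of Z[p_S]. -/

import Mathlib

open MeasureTheory Metric Set Pointwise

noncomputable section

/-- An iterated function system (IFS) of contracting similarities on `ℝ^d`. -/
structure IFS (d : ℕ) : Type 1 where
  ι : Type
  fin : Fintype ι
  f : ι → EuclideanSpace ℝ (Fin d) → EuclideanSpace ℝ (Fin d)
  r : ι → ℝ
  r_pos : ∀ i, 0 < r i
  r_lt_one : ∀ i, r i < 1
  sim : ∀ i x y, dist (f i x) (f i y) = r i * dist x y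

attribute [instance] IFS.fin

namespace IFS

variable {d : ℕ}

/-- `E` is the self-similar set (attractor) of `S`: the unique nonempty compact set
with `E = ⋃ i, S.f i '' E`. -/
def IsAttractor (S : IFS d) (E : Set (EuclideanSpace ℝ (Fin d))) : Prop :=
  E.Nonempty ∧ IsCompact E ∧ E = ⋃ i, S.f i '' E

open scoped Classical in
/-- The self-similar set generated by `S`. -/
def attractor (S : IFS d) : Set (EuclideanSpace ℝ (Fin d)) :=
  if h : ∃ E, S.IsAttractor E then h.choose else ∅

/-- `O` is an open set witnessing the open set condition for `S`. -/
def OSCSet (S : IFS d) (O : Set (EuclideanSpace ℝ (Fin d))) : Prop :=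
  O.Nonempty ∧ IsOpen O ∧ Bornology.IsBounded O ∧
    (∀ i, S.f i '' O ⊆ O) ∧ ∀ i j, i ≠ j → Disjoint (S.f i '' O) (S.f j '' O)

/-- The open set condition. -/
def OSC (S : IFS d) : Prop := ∃ O, S.OSCSet O

/-- The strong separation condition. -/
def SSC (S : IFS d) : Prop :=
  ∀ i j : S.ι, i ≠ j → Disjoint (S.f i '' S.attractor) (S.f j '' S.attractor)

/-- `r` is the ratio root of `S`: the ratios are commensurable with common root `r`. -/
def IsRatioRoot (S : IFS d) (r : ℝ) : Prop :=
  0 < r ∧ r < 1 ∧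
    ∃ lam : S.ι → ℕ, (∀ i, 0 < lam i) ∧ (∀ i, S.r i = r ^ lam i) ∧ Finset.univ.gcd lam = 1

/-- The Hausdorff dimension of the attractor of `S`, as a real number. -/
def hdim (S : IFS d) : ℝ := (dimH S.attractor).toReal

/-- Membership in the class TOEC: OSC, commensurable ratios, totally disconnected attractor. -/
def MemTOEC (S : IFS d) : Prop :=
  S.OSC ∧ (∃ r, S.IsRatioRoot r) ∧ IsTotallyDisconnected S.attractor

/-- Membership in TOEC(p, r): measure root `p` and ratio root `r`. -/
def MemTOECpr (S : IFS d) (p r : ℝ) : Prop :=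
  S.MemTOEC ∧ S.IsRatioRoot r ∧ p = r ^ S.hdim

/-- The natural measure of a set: normalized `s`-dimensional Hausdorff measure, `s = dimH E_S`. -/
def natMeasure (S : IFS d) (F : Set (EuclideanSpace ℝ (Fin d))) : ℝ :=
  (μH[S.hdim] F / μH[S.hdim] S.attractor).toReal

/-- `F` is an interior separated set of `E_S`. -/
def IsIntSep (S : IFS d) (F : Set (EuclideanSpace ℝ (Fin d))) : Prop :=
  IsCompact F ∧ F ⊆ S.attractor ∧ IsCompact (S.attractor \ F) ∧ ∃ O, S.OSCSet O ∧ F ⊆ O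

end IFS

/-- The subring `ℤ[p]` of `ℝ` generated by `ℤ` and `p`. -/
def Zring (p : ℝ) : Subring ℝ := Subring.closure {p}

/-- The underlying set of reals of an ideal of a subring of `ℝ`. -/
def idealSet {R : Subring ℝ} (I : Ideal R) : Set ℝ := (fun x : R => (x : ℝ)) '' (I : Set R)

/-- The ideal `I_S` of `ℤ[p]` generated by the natural measures of interior separated sets. -/
def IFS.idealOf {d : ℕ} (S : IFS d) (p : ℝ) : Ideal (Zring p) :=
  Ideal.span {x : Zring p | ∃ F, S.IsIntSep F ∧ (x : ℝ) = S.natMeasure F}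

/-- Two ideals of a subring `R` of `ℝ` lie in the same ideal class: `a·I = b·J`
for some nonzero `a, b ∈ R`. -/
def SameIdealClass {R : Subring ℝ} (I J : Ideal R) : Prop :=
  ∃ a b : R, a ≠ 0 ∧ b ≠ 0 ∧ (a : ℝ) • idealSet I = (b : ℝ) • idealSet J

/-- Lipschitz equivalence of subsets of (possibly different) metric spaces. -/
def LipEquiv {X Y : Type*} [MetricSpace X] [MetricSpace Y] (A : Set X) (B : Set Y) : Prop :=
  ∃ (f : X → Y) (L : ℝ), 1 ≤ L ∧ Set.BijOn f A B ∧
    ∀ x ∈ A, ∀ y ∈ A, L⁻¹ * dist x y ≤ dist (f x) (f y) ∧ dist (f x) (f y) ≤ L * dist x y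

/-- `S` is orthogonally homogeneous: all maps share a single orthogonal part `A`,
i.e. each map has the form `x ↦ r_i • A x + b_i`. -/
def IFS.OrthHomog {d : ℕ} (S : IFS d) : Prop :=
  ∃ A : EuclideanSpace ℝ (Fin d) ≃ₗᵢ[ℝ] EuclideanSpace ℝ (Fin d),
    ∀ i : S.ι, ∃ b : EuclideanSpace ℝ (Fin d), ∀ x, S.f i x = S.r i • A x + b

/-- The convex open set condition: the OSC holds with a convex open set. -/
def IFS.COSC {d : ℕ} (S : IFS d) : Prop := ∃ O, S.OSCSet O ∧ Convex ℝ O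

namespace IFS

open Filter Topology
open scoped NNReal ENNReal

variable {d : ℕ}

/-! ### Words -/

/-- The composition `S.f i₁ ∘ ⋯ ∘ S.f iₙ` along the word `i₁ ⋯ iₙ`. -/
def word (S : IFS d) : List S.ι → EuclideanSpace ℝ (Fin d) → EuclideanSpace ℝ (Fin d)
  | [] => id
  | i :: w => S.f i ∘ S.word w

/-- The contraction ratio of the map `S.word w`. -/
def ratio (S : IFS d) (w : List S.ι) : ℝ := (w.map S.r).prod

variable (S : IFS d)

@[simp] lemma word_nil (x : EuclideanSpace ℝ (Fin d)) : S.word [] x = x := rfl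

@[simp] lemma word_cons (i : S.ι) (w : List S.ι) (x : EuclideanSpace ℝ (Fin d)) :
    S.word (i :: w) x = S.f i (S.word w x) := rfl

lemma word_append (u v : List S.ι) (x : EuclideanSpace ℝ (Fin d)) :
    S.word (u ++ v) x = S.word u (S.word v x) := by
  induction u with
  | nil => rfl
  | cons i u ih => simp [ih]

@[simp] lemma ratio_nil : S.ratio [] = 1 := rfl

@[simp] lemma ratio_cons (i : S.ι) (w : List S.ι) : S.ratio (i :: w) = S.r i * S.ratio w := by
  simp [ratio]

lemma ratio_append (u v : List S.ι) : S.ratio (u ++ v) = S.ratio u * S.ratio v := by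
  simp [ratio]

lemma ratio_pos (w : List S.ι) : 0 < S.ratio w := by
  induction w with
  | nil => simp
  | cons i w ih => simpa using mul_pos (S.r_pos i) ih

lemma ratio_le_one (w : List S.ι) : S.ratio w ≤ 1 := by
  induction w with
  | nil => simp
  | cons i w ih => simpa using mul_le_one₀ (S.r_lt_one i).le (S.ratio_pos w).le ih

lemma ratio_le_of_isPrefix {u v : List S.ι} (h : u <+: v) : S.ratio v ≤ S.ratio u := by
  obtain ⟨t, rfl⟩ := h
  rw [ratio_append]
  exact mul_le_of_le_one_right (S.ratio_pos u).le (S.ratio_le_one t)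

lemma exists_ratio_le_pow :
    ∃ c : ℝ, 0 < c ∧ c < 1 ∧ ∀ w : List S.ι, S.ratio w ≤ c ^ w.length := by
  obtain ⟨c, h0, h1, hc⟩ : ∃ c : ℝ, 0 < c ∧ c < 1 ∧ ∀ i, S.r i ≤ c := by
    cases isEmpty_or_nonempty S.ι with
    | inl h => exact ⟨1 / 2, by norm_num, by norm_num, fun i => h.elim i⟩
    | inr h =>
      obtain ⟨i, hi⟩ := Finite.exists_max S.r
      exact ⟨S.r i, S.r_pos i, S.r_lt_one i, hi⟩
  refine ⟨c, h0, h1, fun w => ?_⟩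
  induction w with
  | nil => simp
  | cons i w ih =>
    rw [ratio_cons, List.length_cons, pow_succ']
    exact mul_le_mul (hc i) ih (S.ratio_pos w).le h0.le

lemma exists_pos_le_r : ∃ c : ℝ, 0 < c ∧ ∀ i, c ≤ S.r i := by
  cases isEmpty_or_nonempty S.ι with
  | inl h => exact ⟨1, by norm_num, fun i => h.elim i⟩
  | inr h =>
    obtain ⟨i, hi⟩ := Finite.exists_min S.r
    exact ⟨S.r i, S.r_pos i, hi⟩

lemma dist_word (w : List S.ι) (x y : EuclideanSpace ℝ (Fin d)) :
    dist (S.word w x) (S.word w y) = S.ratio w * dist x y := by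
  induction w with
  | nil => simp
  | cons i w ih => rw [word_cons, word_cons, S.sim, ih, ratio_cons, mul_assoc]

lemma lipschitzWith_word (w : List S.ι) :
    LipschitzWith ⟨S.ratio w, (S.ratio_pos w).le⟩ (S.word w) :=
  LipschitzWith.of_dist_le_mul fun x y => (S.dist_word w x y).le

lemma continuous_word (w : List S.ι) : Continuous (S.word w) := (S.lipschitzWith_word w).continuous

lemma word_injective (w : List S.ι) : Function.Injective (S.word w) := by
  intro x y h
  have := S.dist_word w x y
  rw [h, dist_self] at this
  exact dist_eq_zero.1 ((mul_eq_zero.1 this.symm).resolve_left (S.ratio_pos w).ne')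

lemma word_surjective (hs : ∀ i, Function.Surjective (S.f i)) (w : List S.ι) :
    Function.Surjective (S.word w) := by
  induction w with
  | nil => exact Function.surjective_id
  | cons i w ih => exact (hs i).comp ih

lemma word_mem {K : Set (EuclideanSpace ℝ (Fin d))} (hK : ∀ i, S.f i '' K ⊆ K) (w : List S.ι)
    {x : EuclideanSpace ℝ (Fin d)} (hx : x ∈ K) : S.word w x ∈ K := by
  induction w with
  | nil => exact hx
  | cons i w ih => exact hK i ⟨_, ih, rfl⟩

variable {S}

lemma OrthHomog.surjective (h : S.OrthHomog) (i : S.ι) : Function.Surjective (S.f i) := by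
  obtain ⟨A, hA⟩ := h
  obtain ⟨b, hb⟩ := hA i
  intro y
  refine ⟨A.symm ((S.r i)⁻¹ • (y - b)), ?_⟩
  rw [hb, A.apply_symm_apply, smul_inv_smul₀ (S.r_pos i).ne', sub_add_cancel]

/-- Words of the same length share their orthogonal part. -/
lemma OrthHomog.exists_word_eq (h : S.OrthHomog) (n : ℕ) :
    ∃ B : EuclideanSpace ℝ (Fin d) ≃ₗᵢ[ℝ] EuclideanSpace ℝ (Fin d),
      ∀ w : List S.ι, w.length = n → ∃ b, ∀ x, S.word w x = S.ratio w • B x + b := by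
  obtain ⟨A, hA⟩ := h
  induction n with
  | zero =>
    refine ⟨LinearIsometryEquiv.refl ℝ _, fun w hw => ⟨0, fun x => ?_⟩⟩
    rw [List.length_eq_zero_iff.1 hw]
    simp
  | succ n ih =>
    obtain ⟨B, hB⟩ := ih
    refine ⟨B.trans A, fun w hw => ?_⟩
    cases w with
    | nil => simp at hw
    | cons i w =>
      obtain ⟨b, hb⟩ := hB w (by simpa using hw)
      obtain ⟨c, hc⟩ := hA i
      refine ⟨S.r i • A b + c, fun x => ?_⟩
      rw [word_cons, hc, hb, ratio_cons, map_add, map_smul, smul_add, smul_smul, add_assoc]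
      rfl

lemma OSCSet.disjoint_word {O : Set (EuclideanSpace ℝ (Fin d))} (hO : S.OSCSet O)
    {u v : List S.ι} (huv : ¬ u <+: v) (hvu : ¬ v <+: u) :
    Disjoint (S.word u '' O) (S.word v '' O) := by
  induction u generalizing v with
  | nil => simp at huv
  | cons i u ih =>
    cases v with
    | nil => simp at hvu
    | cons j v =>
      rw [Set.disjoint_left]
      rintro _ ⟨x, hx, rfl⟩ ⟨y, hy, hxy⟩
      by_cases hij : i = j
      · subst hij
        simp only [List.prefix_cons_inj] at huv hvu
        refine Set.disjoint_left.1 (ih huv hvu) ⟨x, hx, rfl⟩ ⟨y, hy, ?_⟩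
        exact S.word_injective [i] hxy
      · refine Set.disjoint_left.1 (hO.2.2.2.2 i j hij) ⟨_, S.word_mem hO.2.2.2.1 u hx, rfl⟩ ?_
        exact ⟨_, S.word_mem hO.2.2.2.1 v hy, hxy⟩

lemma exists_ratio_mul_lt (D : ℝ) {ε : ℝ} (hε : 0 < ε) :
    ∃ n : ℕ, ∀ w : List S.ι, w.length = n → S.ratio w * D < ε := by
  obtain ⟨c, hc0, hc1, hc⟩ := S.exists_ratio_le_pow
  have hlim : Tendsto (fun n : ℕ => c ^ n * |D|) atTop (𝓝 (0 * |D|)) :=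
    (tendsto_pow_atTop_nhds_zero_of_lt_one hc0.le hc1).mul_const _
  rw [zero_mul] at hlim
  obtain ⟨n, hn⟩ := (hlim.eventually (gt_mem_nhds hε)).exists
  refine ⟨n, fun w hw => lt_of_le_of_lt ?_ hn⟩
  rw [← hw]
  exact (mul_le_mul_of_nonneg_left (le_abs_self D) (S.ratio_pos w).le).trans
    (mul_le_mul_of_nonneg_right (hc w) (abs_nonneg D))

/-! ### Attractors -/

section Attractor

variable {E : Set (EuclideanSpace ℝ (Fin d))}

lemma IsAttractor.image_subset (hE : S.IsAttractor E) (i : S.ι) : S.f i '' E ⊆ E := by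
  conv_rhs => rw [hE.2.2]
  exact Set.subset_iUnion (fun i => S.f i '' E) i

lemma IsAttractor.exists_word (hE : S.IsAttractor E) (n : ℕ)
    {x : EuclideanSpace ℝ (Fin d)} (hx : x ∈ E) :
    ∃ w : List S.ι, w.length = n ∧ x ∈ S.word w '' E := by
  induction n generalizing x with
  | zero => exact ⟨[], rfl, x, hx, rfl⟩
  | succ n ih =>
    rw [hE.2.2] at hx
    obtain ⟨i, y, hy, rfl⟩ := Set.mem_iUnion.1 hx
    obtain ⟨w, hw, z, hz, rfl⟩ := ih hy
    exact ⟨i :: w, by simp [hw], z, hz, rfl⟩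

lemma IsAttractor.subset_closure_oscSet (hE : S.IsAttractor E) {O : Set (EuclideanSpace ℝ (Fin d))}
    (hO : S.OSCSet O) : E ⊆ closure O := by
  intro x hx
  obtain ⟨o, ho⟩ := hO.1
  obtain ⟨D, hD⟩ := hE.2.1.isBounded.subset_closedBall o
  rw [Metric.mem_closure_iff]
  intro ε hε
  obtain ⟨n, hn⟩ := exists_ratio_mul_lt (S := S) D hε
  obtain ⟨w, hw, y, hy, rfl⟩ := hE.exists_word n hx
  refine ⟨S.word w o, S.word_mem hO.2.2.2.1 w ho, lt_of_le_of_lt ?_ (hn w hw)⟩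
  rw [dist_word]
  exact mul_le_mul_of_nonneg_left (Metric.mem_closedBall.1 (hD hy)) (S.ratio_pos w).le

end Attractor

/-! ### The coding map -/

section Coding

local instance : TopologicalSpace S.ι := ⊥

local instance : DiscreteTopology S.ι := ⟨rfl⟩

/-- The first `n` letters of an infinite word. -/
def initialWord (ω : ℕ → S.ι) (n : ℕ) : List S.ι := List.ofFn fun k : Fin n => ω k

@[simp] lemma length_initialWord (ω : ℕ → S.ι) (n : ℕ) : (initialWord ω n).length = n := by
  simp [initialWord]

lemma initialWord_succ (ω : ℕ → S.ι) (n : ℕ) :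
    initialWord ω (n + 1) = ω 0 :: initialWord (fun k => ω (k + 1)) n := by
  simp [initialWord, List.ofFn_succ]

lemma initialWord_succ' (ω : ℕ → S.ι) (n : ℕ) :
    initialWord ω (n + 1) = initialWord ω n ++ [ω n] := by
  rw [initialWord, List.ofFn_succ_last]
  rfl

lemma eq_initialWord_of_isPrefix {ω : ℕ → S.ι} {n : ℕ} {v : List S.ι}
    (h : v <+: initialWord ω n) : v = initialWord ω v.length := by
  refine List.ext_getElem (by simp) fun k hk _ => ?_
  have := h.getElem hk
  simpa [initialWord] using this

lemma dist_le_of_mem_word_image {K : Set (EuclideanSpace ℝ (Fin d))} (hK : Bornology.IsBounded K)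
    {w : List S.ι} {x y : EuclideanSpace ℝ (Fin d)} (hx : x ∈ S.word w '' K)
    (hy : y ∈ S.word w '' K) : dist x y ≤ S.ratio w * Metric.diam K := by
  obtain ⟨x, hx, rfl⟩ := hx
  obtain ⟨y, hy, rfl⟩ := hy
  rw [dist_word]
  exact mul_le_mul_of_nonneg_left (Metric.dist_le_diam_of_mem hK hx hy) (S.ratio_pos w).le

lemma eq_of_forall_mem_initialWord_image {K : Set (EuclideanSpace ℝ (Fin d))}
    (hK : Bornology.IsBounded K) {ω : ℕ → S.ι} {x y : EuclideanSpace ℝ (Fin d)}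
    (hx : ∀ n, x ∈ S.word (initialWord ω n) '' K)
    (hy : ∀ n, y ∈ S.word (initialWord ω n) '' K) : x = y := by
  refine dist_le_zero.1 (le_of_forall_pos_le_add fun ε hε => ?_)
  obtain ⟨n, hn⟩ := exists_ratio_mul_lt (S := S) (Metric.diam K) hε
  rw [zero_add]
  exact (dist_le_of_mem_word_image hK (hx n) (hy n)).trans (hn _ (length_initialWord ω n)).le

lemma exists_coding {K : Set (EuclideanSpace ℝ (Fin d))} (hK : IsCompact K) (hne : K.Nonempty)
    (hsub : ∀ i, S.f i '' K ⊆ K) :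
    ∃ π : (ℕ → S.ι) → EuclideanSpace ℝ (Fin d), Continuous π ∧
      ∀ ω n, π ω ∈ S.word (initialWord ω n) '' K := by
  have hmem (ω : ℕ → S.ι) : (⋂ n, S.word (initialWord ω n) '' K).Nonempty := by
    refine IsCompact.nonempty_iInter_of_sequence_nonempty_isCompact_isClosed _ (fun n => ?_)
      (fun n => hne.image _) (hK.image (S.continuous_word _))
      (fun n => (hK.image (S.continuous_word _)).isClosed)
    rintro _ ⟨x, hx, rfl⟩
    rw [initialWord_succ', word_append]
    exact ⟨_, S.word_mem hsub [ω n] hx, rfl⟩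
  choose π hπ using hmem
  simp only [Set.mem_iInter] at hπ
  refine ⟨π, continuous_iff_continuousAt.2 fun ω => Metric.tendsto_nhds.2 fun ε hε => ?_, hπ⟩
  obtain ⟨n, hn⟩ := exists_ratio_mul_lt (S := S) (Metric.diam K) hε
  have hev : ∀ᶠ η in 𝓝 ω, ∀ k : Fin n, η k = ω k := by
    refine eventually_all.2 fun k => ?_
    exact (continuous_apply (k : ℕ)).continuousAt.eventually
      (mem_nhds_discrete.2 (Set.mem_singleton (ω k)))
  filter_upwards [hev] with η hη
  have h : initialWord η n = initialWord ω n := congrArg List.ofFn (funext hη)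
  refine (dist_le_of_mem_word_image hK.isBounded (hπ η n) ?_).trans_lt (hn _ (by simp))
  rw [h]
  exact hπ ω n

lemma exists_isAttractor [Nonempty S.ι] (h : S.OSC) : ∃ E, S.IsAttractor E := by
  obtain ⟨O, hne, -, hb, hsub, -⟩ := h
  have hK : IsCompact (closure O) := hb.isCompact_closure
  have hcl (i : S.ι) : S.f i '' closure O ⊆ closure O :=
    (image_closure_subset_closure_image (S.continuous_word [i])).trans (closure_mono (hsub i))
  obtain ⟨π, hπ, hmem⟩ := exists_coding hK hne.closure hcl
  have hshift (ω : ℕ → S.ι) : π ω = S.f (ω 0) (π fun k => ω (k + 1)) := by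
    refine eq_of_forall_mem_initialWord_image hK.isBounded (hmem ω) fun n => ?_
    cases n with
    | zero =>
      refine ⟨_, ?_, rfl⟩
      obtain ⟨x, hx, hx'⟩ := hmem (fun k => ω (k + 1)) 0
      exact hcl _ ⟨x, hx, congrArg _ hx'⟩
    | succ n =>
      rw [initialWord_succ]
      obtain ⟨x, hx, hx'⟩ := hmem (fun k => ω (k + 1)) n
      exact ⟨x, hx, congrArg (S.f (ω 0)) hx'⟩
  refine ⟨Set.range π, Set.range_nonempty π, isCompact_range hπ, Set.Subset.antisymm ?_ ?_⟩
  · rintro _ ⟨ω, rfl⟩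
    exact Set.mem_iUnion.2 ⟨ω 0, _, ⟨_, rfl⟩, (hshift ω).symm⟩
  · refine Set.iUnion_subset fun i => ?_
    rintro _ ⟨_, ⟨ω, rfl⟩, rfl⟩
    exact ⟨fun n => Nat.casesOn n i ω, hshift _⟩

lemma isAttractor_attractor [Nonempty S.ι] (h : S.OSC) : S.IsAttractor S.attractor := by
  have hE := exists_isAttractor h
  rw [attractor, dif_pos hE]
  exact hE.choose_spec

end Coding

/-! ### Stopping words -/

section Stopping

/-- The words at which the ratio first drops to `δ` or below. -/
def stopping (S : IFS d) (δ : ℝ) : Set (List S.ι) :=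
  {w | S.ratio w ≤ δ ∧ δ < S.ratio w.dropLast}

lemma eq_of_prefix_of_mem_stopping {δ : ℝ} {u v : List S.ι} (hu : u ∈ S.stopping δ)
    (hv : v ∈ S.stopping δ) (h : u <+: v) : u = v := by
  by_contra hne
  have hlt : u.length < v.length :=
    lt_of_le_of_ne h.length_le fun hl => hne (h.eq_of_length hl)
  have : u <+: v.dropLast := by
    refine List.prefix_of_prefix_length_le h (List.dropLast_prefix v) ?_
    rw [List.length_dropLast]
    omega
  exact absurd (S.ratio_le_of_isPrefix this) (not_le.2 (hu.1.trans_lt hv.2))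

lemma exists_prefix_mem_stopping {δ : ℝ} (hδ : δ < 1) (w : List S.ι) (hw : S.ratio w ≤ δ) :
    ∃ v ∈ S.stopping δ, v <+: w := by
  induction w using List.reverseRecOn with
  | nil => simp at hw; linarith
  | append_singleton w i ih =>
    rcases le_or_gt (S.ratio w) δ with h | h
    · obtain ⟨v, hv, hvw⟩ := ih h
      exact ⟨v, hv, hvw.trans (List.prefix_append _ _)⟩
    · exact ⟨w ++ [i], ⟨hw, by simpa using h⟩, List.prefix_rfl⟩

lemma lt_ratio_of_mem_stopping {c : ℝ} (hc : ∀ i, c ≤ S.r i) {δ : ℝ} (hδ : δ < 1)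
    (hδ0 : 0 < δ) {w : List S.ι} (hw : w ∈ S.stopping δ) : c * δ ≤ S.ratio w := by
  induction w using List.reverseRecOn with
  | nil => have := hw.1; simp at this; linarith
  | append_singleton w i _ =>
    have h2 : δ < S.ratio w := by simpa using hw.2
    rw [ratio_append, ratio_cons, ratio_nil, mul_one, mul_comm]
    exact (mul_le_mul_of_nonneg_left (hc i) hδ0.le).trans
      (mul_le_mul_of_nonneg_right h2.le (S.r_pos i).le)

lemma OSCSet.eq_of_mem_stopping {O : Set (EuclideanSpace ℝ (Fin d))} (hO : S.OSCSet O) {δ : ℝ}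
    {u v : List S.ι} (hu : u ∈ S.stopping δ) (hv : v ∈ S.stopping δ)
    {x : EuclideanSpace ℝ (Fin d)} (hxu : x ∈ S.word u '' O) (hxv : x ∈ S.word v '' O) : u = v := by
  by_contra hne
  refine Set.disjoint_left.1 (hO.disjoint_word ?_ ?_) hxu hxv
  · exact fun h => hne (eq_of_prefix_of_mem_stopping hu hv h)
  · exact fun h => hne (eq_of_prefix_of_mem_stopping hv hu h).symm

/-- Under the open set condition, the number of cylinders of size comparable to `δ` which come
within distance `R * δ` of a given point is bounded. -/
lemma OSCSet.exists_card_stopping_le {O : Set (EuclideanSpace ℝ (Fin d))} (hO : S.OSCSet O)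
    (hs : ∀ i, Function.Surjective (S.f i)) {E : Set (EuclideanSpace ℝ (Fin d))}
    (hE : Bornology.IsBounded E) (R : ℝ) :
    ∃ M : ℕ, ∀ δ, 0 < δ → δ < 1 → ∀ x,
      {v ∈ S.stopping δ | ∃ y ∈ E, dist (S.word v y) x ≤ R * δ}.Finite ∧
      {v ∈ S.stopping δ | ∃ y ∈ E, dist (S.word v y) x ≤ R * δ}.ncard ≤ M := by
  obtain ⟨o, ho⟩ := hO.1
  obtain ⟨a, ha, haO⟩ := Metric.isOpen_iff.1 hO.2.1 o ho
  obtain ⟨c, hc0, hc⟩ := S.exists_pos_le_r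
  obtain ⟨D, hD⟩ := hE.subset_closedBall o
  obtain ⟨t, -, htf, ht⟩ := (isCompact_closedBall (0 : EuclideanSpace ℝ (Fin d))
    (D + R)).finite_cover_balls (e := a * c / 2) (by positivity)
  refine ⟨t.ncard, fun δ hδ hδ1 x => ?_⟩
  set I := {v ∈ S.stopping δ | ∃ y ∈ E, dist (S.word v y) x ≤ R * δ} with hI
  have hp (v : List S.ι) (hv : v ∈ I) : ∃ q ∈ t, dist (δ⁻¹ • (S.word v o - x)) q < a * c / 2 := by
    obtain ⟨hv, y, hy, hyx⟩ := hv
    have h1 : dist (S.word v o) x ≤ (D + R) * δ := by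
      have h2 : dist (S.word v o) (S.word v y) ≤ D * δ := by
        rw [dist_word, dist_comm, mul_comm]
        have := hD hy
        rw [Metric.mem_closedBall] at this
        exact mul_le_mul this hv.1 (S.ratio_pos v).le (dist_nonneg.trans this)
      linarith [dist_triangle (S.word v o) (S.word v y) x]
    have h3 : δ⁻¹ • (S.word v o - x) ∈ Metric.closedBall 0 (D + R) := by
      rw [mem_closedBall_zero_iff, norm_smul, ← dist_eq_norm, norm_inv, Real.norm_of_nonneg hδ.le,
        inv_mul_le_iff₀ hδ, mul_comm]
      exact h1
    simpa using ht h3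
  choose! g hgt hg using hp
  have hinj : Set.InjOn g I := by
    intro u hu v hv huv
    have h1 := hg u hu
    rw [huv] at h1
    have h2 : dist (S.word v o) (S.word u o) < a * S.ratio u := by
      have h3 : dist (δ⁻¹ • (S.word v o - x)) (δ⁻¹ • (S.word u o - x)) < a * c := by
        linarith [dist_triangle_right (δ⁻¹ • (S.word v o - x)) (δ⁻¹ • (S.word u o - x)) (g v),
          hg v hv]
      rw [dist_smul₀, norm_inv, Real.norm_of_nonneg hδ.le, inv_mul_lt_iff₀ hδ, dist_sub_right]
        at h3
      have h4 := lt_ratio_of_mem_stopping hc hδ1 hδ hu.1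
      calc _ < δ * (a * c) := h3
        _ = a * (c * δ) := by ring
        _ ≤ _ := mul_le_mul_of_nonneg_left h4 ha.le
    obtain ⟨z, hz⟩ := S.word_surjective hs u (S.word v o)
    rw [← hz, dist_word, mul_comm] at h2
    have hzO : z ∈ O := haO (lt_of_mul_lt_mul_right h2 (S.ratio_pos u).le)
    exact hO.eq_of_mem_stopping hu.1 hv.1 ⟨z, hzO, hz⟩ ⟨o, ho, rfl⟩
  exact ⟨Set.Finite.of_injOn hgt hinj htf, Set.ncard_le_ncard_of_injOn g hgt hinj htf⟩

end Stopping

/-! ### The strong open set condition -/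

/-- The open set condition implies the strong open set condition. -/
lemma IsAttractor.exists_oscSet_inter_nonempty {E : Set (EuclideanSpace ℝ (Fin d))}
    (hE : S.IsAttractor E) (hs : ∀ i, Function.Surjective (S.f i)) (hO : S.OSC) :
    ∃ O, S.OSCSet O ∧ (E ∩ O).Nonempty := by
  obtain ⟨O, hO⟩ := hO
  let nbr (w : List S.ι) : Set (List S.ι) :=
    {v ∈ S.stopping (S.ratio w) |
      ∃ x ∈ E, ∃ y ∈ E, dist (S.word v x) (S.word w y) < S.ratio w}
  obtain ⟨y₀, hy₀⟩ := hE.1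
  obtain ⟨M, hM⟩ := hO.exists_card_stopping_le hs hE.2.1.isBounded (1 + Metric.diam E)
  have hnbr (w : List S.ι) : (nbr w).Finite ∧ (nbr w).ncard ≤ M := by
    rcases (S.ratio_le_one w).lt_or_eq with h1 | h1
    · obtain ⟨hf, hc⟩ := hM (S.ratio w) (S.ratio_pos w) h1 (S.word w y₀)
      have hsub : nbr w ⊆ {v ∈ S.stopping (S.ratio w) |
          ∃ y ∈ E, dist (S.word v y) (S.word w y₀) ≤ (1 + Metric.diam E) * S.ratio w} := by
        rintro v ⟨hv, x, hx, y, hy, hxy⟩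
        refine ⟨hv, x, hx, ?_⟩
        have h2 : dist (S.word w y) (S.word w y₀) ≤ S.ratio w * Metric.diam E := by
          rw [dist_word]
          exact mul_le_mul_of_nonneg_left
            (Metric.dist_le_diam_of_mem hE.2.1.isBounded hy hy₀) (S.ratio_pos w).le
        linarith [dist_triangle (S.word v x) (S.word w y) (S.word w y₀)]
      exact ⟨hf.subset hsub, (Set.ncard_le_ncard hsub hf).trans hc⟩
    · have : nbr w = ∅ := by
        refine Set.eq_empty_of_forall_notMem fun v hv => ?_
        have := hv.1.2
        rw [h1] at this
        exact absurd this (not_lt.2 (S.ratio_le_one _))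
      simp [this]
  obtain ⟨w, hw⟩ : ∃ w, ∀ w', (nbr w').ncard ≤ (nbr w).ncard := by
    have hb : BddAbove (Set.range fun w => (nbr w).ncard) :=
      ⟨M, by rintro _ ⟨w, rfl⟩; exact (hnbr w).2⟩
    obtain ⟨w, hw⟩ := Nat.sSup_mem (Set.range_nonempty fun w => (nbr w).ncard) hb
    exact ⟨w, fun w' => (le_csSup hb ⟨w', rfl⟩).trans hw.ge⟩
  have hmax (u : List S.ι) : nbr (u ++ w) = (u ++ ·) '' nbr w := by
    symm
    refine Set.eq_of_subset_of_ncard_le ?_ ?_ (hnbr _).1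
    · rintro _ ⟨v, ⟨hv, x, hx, y, hy, hxy⟩, rfl⟩
      have hne : v ≠ [] := by
        rintro rfl
        exact absurd hv.2 (not_lt.2 hv.1)
      refine ⟨⟨?_, ?_⟩, x, hx, y, hy, ?_⟩
      · rw [ratio_append, ratio_append]
        exact mul_le_mul_of_nonneg_left hv.1 (S.ratio_pos u).le
      · rw [List.dropLast_append_of_ne_nil hne, ratio_append, ratio_append]
        exact mul_lt_mul_of_pos_left hv.2 (S.ratio_pos u)
      · rw [word_append, word_append, dist_word, ratio_append]
        exact mul_lt_mul_of_pos_left hxy (S.ratio_pos u)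
    · rw [Set.ncard_image_of_injective _ (List.append_right_injective u)]
      exact hw _
  have hfar {i j : S.ι} (hij : i ≠ j) (u v : List S.ι) {x y : EuclideanSpace ℝ (Fin d)}
      (hx : x ∈ E) (hy : y ∈ E) (hr : S.ratio (j :: (v ++ w)) ≤ S.ratio (i :: (u ++ w))) :
      S.ratio (i :: (u ++ w)) ≤
        dist (S.word (i :: (u ++ w)) x) (S.word (j :: (v ++ w)) y) := by
    by_contra! hlt
    have h1 : S.ratio (i :: (u ++ w)) < 1 := by
      rw [ratio_cons]
      exact mul_lt_one_of_nonneg_of_lt_one_left (S.r_pos i).le (S.r_lt_one i) (S.ratio_le_one _)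
    obtain ⟨b, hb, t, hbt⟩ := exists_prefix_mem_stopping h1 _ hr
    have hbn : b ∈ nbr (i :: (u ++ w)) := by
      refine ⟨hb, S.word t y, S.word_mem hE.image_subset t hy, x, hx, ?_⟩
      rw [← word_append, hbt, dist_comm]
      exact hlt
    rw [← List.cons_append, hmax] at hbn
    obtain ⟨c, -, rfl⟩ := hbn
    simp only [List.cons_append, List.cons.injEq] at hbt
    exact hij hbt.1
  refine ⟨⋃ u : List S.ι, Metric.thickening (S.ratio (u ++ w) / 2) (S.word (u ++ w) '' E),
    ⟨?_, ?_, ?_, ?_, ?_⟩, ?_⟩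
  · exact ⟨S.word w y₀, Set.mem_iUnion.2 ⟨[], Metric.self_subset_thickening
      (half_pos (S.ratio_pos _)) _ ⟨y₀, hy₀, rfl⟩⟩⟩
  · exact isOpen_iUnion fun u => Metric.isOpen_thickening
  · refine (hE.2.1.isBounded.thickening (δ := 1)).subset (Set.iUnion_subset fun u => ?_)
    refine (Metric.thickening_mono (by linarith [S.ratio_le_one (u ++ w)]) _).trans
      (Metric.thickening_subset_of_subset _ ?_)
    rintro _ ⟨x, hx, rfl⟩
    exact S.word_mem hE.image_subset _ hx
  · rintro i _ ⟨z, hz, rfl⟩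
    obtain ⟨u, hu⟩ := Set.mem_iUnion.1 hz
    obtain ⟨_, ⟨x, hx, rfl⟩, hzx⟩ := Metric.mem_thickening_iff.1 hu
    refine Set.mem_iUnion.2 ⟨i :: u, Metric.mem_thickening_iff.2 ⟨_, ⟨x, hx, rfl⟩, ?_⟩⟩
    rw [List.cons_append, word_cons, S.sim, ratio_cons, mul_div_assoc]
    exact mul_lt_mul_of_pos_left hzx (S.r_pos i)
  · intro i j hij
    rw [Set.disjoint_left]
    rintro _ ⟨z, hz, rfl⟩ ⟨z', hz', hzz⟩
    obtain ⟨u, hu⟩ := Set.mem_iUnion.1 hz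
    obtain ⟨_, ⟨x, hx, rfl⟩, hzx⟩ := Metric.mem_thickening_iff.1 hu
    obtain ⟨v, hv⟩ := Set.mem_iUnion.1 hz'
    obtain ⟨_, ⟨y, hy, rfl⟩, hzy⟩ := Metric.mem_thickening_iff.1 hv
    have h1 : dist (S.f i z) (S.word (i :: (u ++ w)) x) < S.ratio (i :: (u ++ w)) / 2 := by
      rw [word_cons, S.sim, ratio_cons, mul_div_assoc]
      exact mul_lt_mul_of_pos_left hzx (S.r_pos i)
    have h2 : dist (S.f i z) (S.word (j :: (v ++ w)) y) < S.ratio (j :: (v ++ w)) / 2 := by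
      rw [← hzz, word_cons, S.sim, ratio_cons, mul_div_assoc]
      exact mul_lt_mul_of_pos_left hzy (S.r_pos j)
    have h3 := dist_triangle_left (S.word (i :: (u ++ w)) x) (S.word (j :: (v ++ w)) y) (S.f i z)
    rcases le_total (S.ratio (j :: (v ++ w))) (S.ratio (i :: (u ++ w))) with h | h
    · linarith [hfar hij u v hx hy h]
    · have := hfar hij.symm v u hy hx h
      rw [dist_comm] at this
      linarith
  · exact ⟨S.word w y₀, S.word_mem hE.image_subset w hy₀, Set.mem_iUnion.2 ⟨[],
      Metric.self_subset_thickening (half_pos (S.ratio_pos _)) _ ⟨y₀, hy₀, rfl⟩⟩⟩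

/-! ### Untouched cylinders -/

/-- If `S` is orthogonally homogeneous with a convex open set `O`, then in every nonempty finite
family of words of the same length some word `w` is such that `S.word w x` avoids all the other
cylinders of the family. -/
lemma OSCSet.exists_untouched {O : Set (EuclideanSpace ℝ (Fin d))} (hO : S.OSCSet O)
    (hconv : Convex ℝ O) (hH : S.OrthHomog) {n : ℕ} {W : Set (List S.ι)} (hW : W.Finite)
    (hne : W.Nonempty) (hlen : ∀ w ∈ W, w.length = n) (x : EuclideanSpace ℝ (Fin d)) :
    ∃ w ∈ W, ∀ v ∈ W, v ≠ w → S.word w x ∉ S.word v '' closure O := by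
  by_contra! hcon
  obtain ⟨B, hB⟩ := hH.exists_word_eq (S := S) n
  choose! b hb using hB
  choose! a haW hane hax using hcon
  choose! y hyO hy using hax
  obtain ⟨w₁, hw₁⟩ := hne
  have hit (k : ℕ) : a^[k] w₁ ∈ W := by
    induction k with
    | zero => exact hw₁
    | succ k ih => rw [Function.iterate_succ_apply']; exact haW _ ih
  obtain ⟨w₀, hw₀, m, hm, hper⟩ : ∃ w₀ ∈ W, ∃ m, 0 < m ∧ a^[m] w₀ = w₀ := by
    have := hW.to_subtype
    obtain ⟨i, j, hij, heq⟩ := Finite.exists_ne_map_eq_of_infinite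
      fun k : ℕ => (⟨a^[k] w₁, hit k⟩ : W)
    wlog hlt : i < j generalizing i j
    · exact this j i hij.symm heq.symm (lt_of_le_of_ne (not_lt.1 hlt) hij.symm)
    refine ⟨a^[i] w₁, hit i, j - i, by omega, ?_⟩
    rw [← Function.iterate_add_apply, Nat.sub_add_cancel hlt.le]
    exact (congrArg Subtype.val heq).symm
  have hit' (k : ℕ) : a^[k] w₀ ∈ W := by
    induction k with
    | zero => exact hw₀
    | succ k ih => rw [Function.iterate_succ_apply']; exact haW _ ih
  set ρ : ℕ → ℝ := fun k => S.ratio (a^[k] w₀) with hρ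
  set z : ℕ → EuclideanSpace ℝ (Fin d) := fun k => y (a^[k] w₀) with hz
  have hstep (k : ℕ) : ρ (k + 1) • B (z k) - ρ k • B x = b (a^[k] w₀) - b (a^[k + 1] w₀) := by
    have h := hy _ (hit' k)
    rw [hb _ (hlen _ (hit' k)), hb _ (hlen _ (haW _ (hit' k))),
      ← Function.iterate_succ_apply' a k w₀] at h
    rw [sub_eq_sub_iff_add_eq_add, h, add_comm]
  have hsum : ∑ k ∈ Finset.range m, ρ (k + 1) • z k = (∑ k ∈ Finset.range m, ρ (k + 1)) • x := by
    have h1 : ∑ k ∈ Finset.range m, ρ (k + 1) = ∑ k ∈ Finset.range m, ρ k := by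
      rw [← sub_eq_zero, ← Finset.sum_sub_distrib, Finset.sum_range_sub]
      simp [hρ, hper]
    have h2 : ∑ k ∈ Finset.range m, (ρ (k + 1) • B (z k) - ρ k • B x) = 0 := by
      simp_rw [hstep]
      rw [Finset.sum_range_sub' fun k => b (a^[k] w₀)]
      simp [hper]
    rw [h1]
    apply B.injective
    rw [Finset.sum_sub_distrib, ← Finset.sum_smul, sub_eq_zero] at h2
    simpa using h2
  have hρpos (k : ℕ) : 0 < ρ k := S.ratio_pos _
  set T := ∑ k ∈ Finset.range m, ρ (k + 1) with hT
  have hTle : ρ 1 ≤ T :=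
    Finset.single_le_sum (f := fun k => ρ (k + 1)) (fun k _ => (hρpos _).le)
      (Finset.mem_range.2 hm)
  have hTpos : 0 < T := (hρpos 1).trans_le hTle
  have hTle0 : ρ 0 ≤ T := by
    obtain ⟨l, rfl⟩ : ∃ l, m = l + 1 := ⟨m - 1, by omega⟩
    have : ρ 0 = ρ (l + 1) := by simp only [hρ, hper, Function.iterate_zero, id]
    rw [this]
    exact Finset.single_le_sum (f := fun k => ρ (k + 1)) (fun k _ => (hρpos _).le)
      (Finset.mem_range.2 (Nat.lt_succ_self l))
  obtain ⟨o, ho⟩ := hO.1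
  have hzcl (k : ℕ) : z k ∈ closure O := hyO _ (hit' k)
  have hintO : interior O = O := hO.2.1.interior_eq
  have hint : interior (closure O) = O := by
    rw [hconv.interior_closure_eq_interior_of_nonempty_interior (by rw [hintO]; exact hO.1), hintO]
  have hq : x + (ρ 1 / T) • (o - z 0) ∈ O := by
    have hg : ∀ o' ∈ O, x + (ρ 1 / T) • (o' - z 0) ∈ closure O := by
      intro o' ho'
      have hmem : (Finset.range m).centerMass (fun k => ρ (k + 1))
          (fun k => if k = 0 then o' else z k) ∈ closure O := by
        refine hconv.closure.centerMass_mem (fun k _ => (hρpos _).le) hTpos fun k _ => ?_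
        split_ifs
        · exact subset_closure ho'
        · exact hzcl k
      convert hmem using 1
      have h3 : ∑ k ∈ Finset.range m, ρ (k + 1) • (if k = 0 then o' else z k)
          = T • x + ρ 1 • (o' - z 0) := by
        rw [← hsum, ← sub_eq_iff_eq_add', ← Finset.sum_sub_distrib,
          Finset.sum_eq_single_of_mem 0 (Finset.mem_range.2 hm)]
        · simp [smul_sub]
        · intro k _ hk
          simp [hk]
      rw [Finset.centerMass, h3, ← hT, smul_add, smul_smul, inv_mul_cancel₀ hTpos.ne', one_smul,
        smul_smul, div_eq_inv_mul]
    rw [← hint, mem_interior]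
    have hc : ρ 1 / T ≠ 0 := (div_pos (hρpos 1) hTpos).ne'
    refine ⟨(fun o' => x + (ρ 1 / T) • (o' - z 0)) '' O, ?_, ?_, ⟨o, ho, rfl⟩⟩
    · rintro _ ⟨o', ho', rfl⟩
      exact hg o' ho'
    · have := ((Homeomorph.addRight (-z 0)).trans
        ((Homeomorph.smulOfNeZero _ hc).trans (Homeomorph.addLeft x))).isOpenMap O hO.2.1
      simp only [sub_eq_add_neg]
      exact this
  have hq' : z 0 + (ρ 0 / T) • (o - z 0) ∈ O := by
    have := hconv.add_smul_sub_mem_interior' (hzcl 0) (hintO.symm ▸ ho)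
      ⟨div_pos (hρpos 0) hTpos, (div_le_one hTpos).2 hTle0⟩
    rwa [hintO] at this
  have hlen0 := hlen _ hw₀
  have hlen1 := hlen _ (haW _ hw₀)
  refine Set.disjoint_left.1 (hO.disjoint_word (u := w₀) (v := a w₀) ?_ ?_)
    ⟨_, hq, rfl⟩ ⟨_, hq', ?_⟩
  · exact fun h => hane _ hw₀ (h.eq_of_length (hlen0.trans hlen1.symm)).symm
  · exact fun h => hane _ hw₀ (h.eq_of_length (hlen1.trans hlen0.symm))
  · have h0 := hstep 0
    simp only [hρ, hz, Function.iterate_zero, id, Function.iterate_succ, Function.comp,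
      zero_add] at h0 ⊢
    rw [hb _ hlen0, hb _ hlen1, map_add, map_add, map_smul, map_smul, smul_add, smul_add,
      smul_smul, smul_smul, mul_div_assoc', mul_div_assoc', mul_comm (S.ratio (a w₀))]
    have h1 : S.ratio (a w₀) • B (y w₀) + b (a w₀) = S.ratio w₀ • B x + b w₀ := by
      rw [add_comm (S.ratio w₀ • B x)]
      exact sub_eq_sub_iff_add_eq_add.1 h0
    rw [add_right_comm, h1, add_right_comm]

/-! ### Hausdorff measure of the attractor -/

variable (S) in
lemma exists_sum_rpow_eq_one [Nonempty S.ι] : ∃ s : ℝ≥0, ∑ i, S.r i ^ (s : ℝ) = 1 := by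
  have hcont : Continuous fun t : ℝ => ∑ i, S.r i ^ t :=
    continuous_finsetSum _ fun i _ => Real.continuous_const_rpow (S.r_pos i).ne'
  have hlim : Tendsto (fun t : ℝ => ∑ i, S.r i ^ t) atTop (𝓝 0) := by
    have := tendsto_finsetSum (Finset.univ : Finset S.ι) fun i _ =>
      tendsto_rpow_atTop_of_base_lt_one (S.r i) (by linarith [S.r_pos i]) (S.r_lt_one i)
    simpa using this
  obtain ⟨t, ht, ht0⟩ := ((hlim.eventually (gt_mem_nhds one_pos)).and
    (eventually_ge_atTop (0 : ℝ))).exists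
  have h0 : (1 : ℝ) ≤ ∑ i, S.r i ^ (0 : ℝ) := by
    simpa using Nat.one_le_iff_ne_zero.2 (Fintype.card_ne_zero (α := S.ι))
  obtain ⟨s, hs, hs1⟩ := intermediate_value_Icc' ht0 hcont.continuousOn ⟨ht.le, h0⟩
  exact ⟨⟨s, hs.1⟩, hs1⟩

lemma hausdorffMeasure_word_image (w : List S.ι) (s : ℝ≥0) (F : Set (EuclideanSpace ℝ (Fin d))) :
    μH[s] (S.word w '' F) = ENNReal.ofReal (S.ratio w ^ (s : ℝ)) * μH[s] F := by
  set K : ℝ≥0 := ⟨S.ratio w, (S.ratio_pos w).le⟩ with hK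
  have hK0 : K ≠ 0 := fun h => (S.ratio_pos w).ne' (congrArg NNReal.toReal h)
  have hpow : ENNReal.ofReal (S.ratio w ^ (s : ℝ)) = (K : ℝ≥0∞) ^ (s : ℝ) := by
    rw [← ENNReal.ofReal_rpow_of_pos (S.ratio_pos w)]
    congr 1
    exact ENNReal.ofReal_eq_coe_nnreal (S.ratio_pos w).le
  rw [hpow]
  refine le_antisymm ((S.lipschitzWith_word w).hausdorffMeasure_image_le s.2 F) ?_
  have hanti : AntilipschitzWith K⁻¹ (S.word w) := by
    refine AntilipschitzWith.of_le_mul_dist fun x y => ?_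
    rw [dist_word, NNReal.coe_inv, hK]
    exact (inv_mul_cancel_left₀ (S.ratio_pos w).ne' _).ge
  have h := hanti.le_hausdorffMeasure_image s.2 F
  have hKs : (K : ℝ≥0∞) ^ (s : ℝ) ≠ 0 := by
    simp [ENNReal.rpow_eq_zero_iff, hK0]
  have hKs' : (K : ℝ≥0∞) ^ (s : ℝ) ≠ ⊤ := ENNReal.rpow_ne_top_of_nonneg s.2 ENNReal.coe_ne_top
  rw [ENNReal.coe_inv hK0, ENNReal.inv_rpow] at h
  calc (K : ℝ≥0∞) ^ (s : ℝ) * μH[s] F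
      ≤ (K : ℝ≥0∞) ^ (s : ℝ) * (((K : ℝ≥0∞) ^ (s : ℝ))⁻¹ * μH[s] (S.word w '' F)) := by
        gcongr
        exact h
    _ = μH[s] (S.word w '' F) := by rw [← mul_assoc, ENNReal.mul_inv_cancel hKs hKs', one_mul]

lemma ratio_rpow (w : List S.ι) (s : ℝ) : S.ratio w ^ s = (w.map fun i => S.r i ^ s).prod := by
  induction w with
  | nil => simp
  | cons i w ih => simp [Real.mul_rpow (S.r_pos i).le (S.ratio_pos w).le, ih]

lemma sum_ratio_ofFn_rpow {s : ℝ} (hs : ∑ i, S.r i ^ s = 1) (n : ℕ) :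
    ∑ w : Fin n → S.ι, S.ratio (List.ofFn w) ^ s = 1 := by
  classical
  simp_rw [ratio_rpow, List.map_ofFn, List.prod_ofFn, Function.comp_apply]
  rw [← Fintype.prod_sum fun (_ : Fin n) i => S.r i ^ s]
  simp [hs]

lemma IsAttractor.hausdorffMeasure_ne_top {E : Set (EuclideanSpace ℝ (Fin d))}
    (hE : S.IsAttractor E) {s : ℝ≥0} (hs : ∑ i, S.r i ^ (s : ℝ) = 1) : μH[s] E ≠ ⊤ := by
  obtain ⟨c, hc0, hc1, hc⟩ := S.exists_ratio_le_pow
  set D : ℝ≥0∞ := ediam E with hD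
  have hDtop : D ≠ ⊤ := hE.2.1.isBounded.ediam_ne_top
  have hdiam (w : List S.ι) : ediam (S.word w '' E) ≤ ENNReal.ofReal (S.ratio w) * D := by
    refine ((S.lipschitzWith_word w).ediam_image_le E).trans_eq ?_
    rw [ENNReal.ofReal_eq_coe_nnreal (S.ratio_pos w).le, hD]
    rfl
  have hlim : Tendsto (fun n : ℕ => ENNReal.ofReal (c ^ n) * D) atTop (𝓝 0) := by
    have h1 := ENNReal.tendsto_ofReal (tendsto_pow_atTop_nhds_zero_of_lt_one hc0.le hc1)
    have h2 := ENNReal.Tendsto.mul_const h1 (Or.inr hDtop)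
    simpa using h2
  have hle := Measure.hausdorffMeasure_le_liminf_sum (s : ℝ) E _ hlim
    (fun n (w : Fin n → S.ι) => S.word (List.ofFn w) '' E)
    (Eventually.of_forall fun n w => (hdiam _).trans (by
      gcongr
      simpa using hc (List.ofFn w)))
    (Eventually.of_forall fun n x hx => by
      obtain ⟨w, rfl, hxw⟩ := hE.exists_word n hx
      refine Set.mem_iUnion.2 ⟨w.get, ?_⟩
      rwa [List.ofFn_get])
  refine ne_top_of_le_ne_top (ENNReal.rpow_ne_top_of_nonneg s.2 hDtop : D ^ (s : ℝ) ≠ ⊤)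
    (hle.trans ?_)
  refine (liminf_le_liminf (v := fun _ => D ^ (s : ℝ)) (Eventually.of_forall fun n => ?_)).trans
    (liminf_const _).le
  calc ∑ w : Fin n → S.ι, ediam (S.word (List.ofFn w) '' E) ^ (s : ℝ)
      ≤ ∑ w : Fin n → S.ι, ENNReal.ofReal (S.ratio (List.ofFn w) ^ (s : ℝ)) * D ^ (s : ℝ) := by
        refine Finset.sum_le_sum fun w _ => ?_
        rw [← ENNReal.ofReal_rpow_of_pos (S.ratio_pos _),
          ← ENNReal.mul_rpow_of_nonneg _ _ (NNReal.coe_nonneg s)]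
        exact ENNReal.rpow_le_rpow (hdiam _) s.2
    _ = D ^ (s : ℝ) := by
        rw [← Finset.sum_mul, ← ENNReal.ofReal_sum_of_nonneg, sum_ratio_ofFn_rpow hs,
          ENNReal.ofReal_one, one_mul]
        exact fun w _ => (Real.rpow_pos_of_pos (S.ratio_pos _) _).le

section MassDistribution

local instance : TopologicalSpace S.ι := ⊥

local instance : DiscreteTopology S.ι := ⟨rfl⟩

local instance : MeasurableSpace S.ι := ⊤

local instance : BorelSpace S.ι := ⟨borel_eq_top_of_discrete.symm⟩

lemma exists_bernoulli {s : ℝ} (hs : ∑ i, S.r i ^ s = 1) :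
    ∃ P : Measure (ℕ → S.ι), IsProbabilityMeasure P ∧
      ∀ v : List S.ι, P {ω | initialWord ω v.length = v} = ENNReal.ofReal (S.ratio v ^ s) := by
  have hp : ∑ i, ENNReal.ofReal (S.r i ^ s) = 1 := by
    rw [← ENNReal.ofReal_sum_of_nonneg fun i _ => (Real.rpow_pos_of_pos (S.r_pos i) s).le, hs,
      ENNReal.ofReal_one]
  let ν : Measure S.ι := (PMF.ofFintype _ hp).toMeasure
  refine ⟨Measure.infinitePi fun _ => ν, inferInstance, fun v => ?_⟩
  have hset : {ω : ℕ → S.ι | initialWord ω v.length = v} =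
      Set.pi (Finset.range v.length) fun k => {i | v[k]? = some i} := by
    ext ω
    simp only [Set.mem_ofPred_eq, initialWord, Set.mem_pi, Finset.coe_range, Set.mem_Iio]
    rw [List.ext_getElem_iff]
    simp only [List.length_ofFn, true_and, List.getElem_ofFn]
    refine ⟨fun h k hk => ?_, fun h k hk _ => ?_⟩
    · rw [List.getElem?_eq_getElem hk, h k hk hk]
    · have := h k hk
      rw [List.getElem?_eq_getElem hk] at this
      exact (Option.some.inj this).symm
  have hprod : S.ratio v ^ s = ∏ k : Fin v.length, S.r v[k] ^ s := by
    conv_lhs => rw [ratio_rpow, ← List.ofFn_get v, List.map_ofFn, List.prod_ofFn]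
    rfl
  rw [hset, Measure.infinitePi_pi _ fun _ _ => MeasurableSet.of_discrete, Finset.prod_range, hprod,
    ENNReal.ofReal_prod_of_nonneg fun i _ => (Real.rpow_pos_of_pos (S.r_pos _) s).le]
  refine Finset.prod_congr rfl fun k _ => ?_
  have : {i | v[(k : ℕ)]? = some i} = {v[k]} := by
    ext i
    simp [eq_comm]
  rw [this, PMF.toMeasure_apply_singleton _ _ (measurableSet_singleton _), PMF.ofFintype_apply]

lemma IsAttractor.hausdorffMeasure_ne_zero {E : Set (EuclideanSpace ℝ (Fin d))}
    (hE : S.IsAttractor E) (hsurj : ∀ i, Function.Surjective (S.f i)) (hO : S.OSC) {s : ℝ≥0}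
    (hs : ∑ i, S.r i ^ (s : ℝ) = 1) : μH[s] E ≠ 0 := by
  obtain ⟨O, hO⟩ := hO
  obtain ⟨P, hP, hcyl⟩ := exists_bernoulli hs
  obtain ⟨π, hπ, hmem⟩ := exists_coding hE.2.1 hE.1 hE.image_subset
  obtain ⟨M, hM⟩ := hO.exists_card_stopping_le hsurj hE.2.1.isBounded 1
  set μ : Measure (EuclideanSpace ℝ (Fin d)) := P.map π with hμ
  have hball (U : Set (EuclideanSpace ℝ (Fin d))) {δ : ℝ} (hδ : 0 < δ) (hδ1 : δ < 1)
      (hU : ediam U ≤ ENNReal.ofReal δ) : μ U ≤ M * ENNReal.ofReal δ ^ (s : ℝ) := by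
    rcases U.eq_empty_or_nonempty with rfl | ⟨x, hx⟩
    · simp
    obtain ⟨hf, hcard⟩ := hM δ hδ hδ1 x
    set I := {v ∈ S.stopping δ | ∃ y ∈ E, dist (S.word v y) x ≤ 1 * δ} with hI
    calc μ U ≤ μ (closure U) := measure_mono subset_closure
      _ = P (π ⁻¹' closure U) := Measure.map_apply hπ.measurable isClosed_closure.measurableSet
      _ ≤ P (⋃ v ∈ hf.toFinset, {ω | initialWord ω v.length = v}) := by
        refine measure_mono fun ω hω => ?_
        obtain ⟨n, hn⟩ := exists_ratio_mul_lt (S := S) 1 hδ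
        obtain ⟨v, hv, t, hvt⟩ := exists_prefix_mem_stopping hδ1 (initialWord ω n)
          (by simpa using (hn _ (length_initialWord ω n)).le)
        have hpre : initialWord ω v.length = v :=
          eq_initialWord_of_isPrefix ⟨t, hvt⟩ |>.symm
        refine Set.mem_iUnion₂.2 ⟨v, hf.mem_toFinset.2 ⟨hv, ?_⟩, hpre⟩
        obtain ⟨y, hy, hyω⟩ := hmem ω v.length
        rw [hpre] at hyω
        refine ⟨y, hy, ?_⟩
        rw [hyω, one_mul, ← ENNReal.ofReal_le_ofReal_iff hδ.le, ← edist_dist]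
        have hω' : π ω ∈ closure U := hω
        refine (Metric.edist_le_ediam_of_mem hω' (subset_closure hx)).trans ?_
        rwa [Metric.ediam_closure]
      _ ≤ ∑ v ∈ hf.toFinset, P {ω | initialWord ω v.length = v} := measure_biUnion_finset_le _ _
      _ ≤ ∑ v ∈ hf.toFinset, ENNReal.ofReal δ ^ (s : ℝ) := by
        refine Finset.sum_le_sum fun v hv => ?_
        rw [hcyl, ENNReal.ofReal_rpow_of_pos hδ]
        refine ENNReal.ofReal_le_ofReal (Real.rpow_le_rpow (S.ratio_pos v).le ?_ s.2)
        exact ((hf.mem_toFinset.1 hv).1).1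
      _ ≤ M * ENNReal.ofReal δ ^ (s : ℝ) := by
        rw [Finset.sum_const, nsmul_eq_mul]
        gcongr
        rwa [← Set.ncard_eq_toFinset_card _ hf]
  have hdiam (U : Set (EuclideanSpace ℝ (Fin d))) (hU : ediam U ≤ ENNReal.ofReal (1 / 2)) :
      μ U ≤ M * ediam U ^ (s : ℝ) := by
    have hUtop : ediam U ≠ ⊤ := ne_top_of_le_ne_top ENNReal.ofReal_ne_top hU
    set t := (ediam U).toReal with ht
    have htU : ENNReal.ofReal t = ediam U := ENNReal.ofReal_toReal hUtop
    have ht0 : 0 ≤ t := ENNReal.toReal_nonneg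
    have ht1 : t < 1 := by
      have := ENNReal.toReal_le_of_le_ofReal (by norm_num) hU
      linarith
    rw [← htU]
    have hcont : Tendsto (fun δ => (M : ℝ≥0∞) * ENNReal.ofReal δ ^ (s : ℝ)) (𝓝[>] t)
        (𝓝 (M * ENNReal.ofReal t ^ (s : ℝ))) := by
      refine ENNReal.Tendsto.const_mul ?_ (Or.inr (ENNReal.natCast_ne_top M))
      exact ((ENNReal.continuous_rpow_const.comp ENNReal.continuous_ofReal).tendsto t).mono_left
        nhdsWithin_le_nhds
    refine ge_of_tendsto hcont ?_
    filter_upwards [Ioo_mem_nhdsGT ht1] with δ hδ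
    refine hball U (ht0.trans_lt hδ.1) hδ.2 ?_
    rw [← htU]
    exact ENNReal.ofReal_le_ofReal hδ.1.le
  have hle : ((M : ℝ≥0∞) + 1)⁻¹ • μ ≤ μH[s] := by
    refine Measure.le_hausdorffMeasure _ _ _ (ENNReal.ofReal_pos.2 one_half_pos) fun U hU => ?_
    rw [Measure.smul_apply, smul_eq_mul, ENNReal.inv_mul_le_iff (by simp) (by simp)]
    exact (hdiam U hU).trans (by gcongr; exact le_self_add)
  have hμE : μ E = 1 := by
    rw [hμ, Measure.map_apply hπ.measurable hE.2.1.isClosed.measurableSet]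
    have : π ⁻¹' E = Set.univ := Set.eq_univ_of_forall fun ω => by
      obtain ⟨y, hy, hyω⟩ := hmem ω 0
      rw [Set.mem_preimage, ← hyω]
      exact hy
    rw [this, measure_univ]
  intro h0
  have := hle E
  rw [h0, Measure.smul_apply, hμE] at this
  simp at this

end MassDistribution

/-! ### The natural measure -/

section NatMeasure

lemma hdim_spec [Nonempty S.ι] (hsurj : ∀ i, Function.Surjective (S.f i)) (hO : S.OSC) :
    ∃ s : ℝ≥0, S.hdim = s ∧ ∑ i, S.r i ^ (s : ℝ) = 1 ∧ μH[s] S.attractor ≠ 0 ∧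
      μH[s] S.attractor ≠ ⊤ := by
  obtain ⟨s, hs⟩ := S.exists_sum_rpow_eq_one
  have hE := isAttractor_attractor hO
  have h0 := hE.hausdorffMeasure_ne_zero hsurj hO hs
  have htop := hE.hausdorffMeasure_ne_top hs
  refine ⟨s, ?_, hs, h0, htop⟩
  rw [hdim, dimH_of_hausdorffMeasure_ne_zero_ne_top h0 htop, ENNReal.coe_toReal]

variable [Nonempty S.ι]

lemma sum_r_rpow_hdim (hsurj : ∀ i, Function.Surjective (S.f i)) (hO : S.OSC) :
    ∑ i, S.r i ^ S.hdim = 1 := by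
  obtain ⟨s, hs, h1, -, -⟩ := hdim_spec hsurj hO
  rw [hs, h1]

lemma natMeasure_attractor (hsurj : ∀ i, Function.Surjective (S.f i)) (hO : S.OSC) :
    S.natMeasure S.attractor = 1 := by
  obtain ⟨s, hs, -, h0, htop⟩ := hdim_spec hsurj hO
  rw [natMeasure, hs, ENNReal.div_self h0 htop, ENNReal.toReal_one]

lemma natMeasure_word_image (hsurj : ∀ i, Function.Surjective (S.f i)) (hO : S.OSC)
    (w : List S.ι) (F : Set (EuclideanSpace ℝ (Fin d))) :
    S.natMeasure (S.word w '' F) = S.ratio w ^ S.hdim * S.natMeasure F := by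
  obtain ⟨s, hs, -, h0, htop⟩ := hdim_spec hsurj hO
  rw [natMeasure, natMeasure, hs, hausdorffMeasure_word_image, mul_div_assoc, ENNReal.toReal_mul,
    ENNReal.toReal_ofReal (Real.rpow_pos_of_pos (S.ratio_pos w) _).le]

lemma natMeasure_union (hsurj : ∀ i, Function.Surjective (S.f i)) (hO : S.OSC)
    {F G : Set (EuclideanSpace ℝ (Fin d))} (hFG : Disjoint F G)
    (hG : MeasurableSet G) (hFE : F ⊆ S.attractor) (hGE : G ⊆ S.attractor) :
    S.natMeasure (F ∪ G) = S.natMeasure F + S.natMeasure G := by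
  obtain ⟨s, hs, -, h0, htop⟩ := hdim_spec hsurj hO
  have hfin {A : Set (EuclideanSpace ℝ (Fin d))} (hA : A ⊆ S.attractor) :
      μH[s] A / μH[s] S.attractor ≠ ⊤ :=
    ENNReal.div_ne_top (ne_top_of_le_ne_top htop (measure_mono hA)) h0
  rw [natMeasure, natMeasure, natMeasure, hs, measure_union hFG hG, ENNReal.add_div,
    ENNReal.toReal_add (hfin hFE) (hfin hGE)]

lemma natMeasure_eq_sum (hsurj : ∀ i, Function.Surjective (S.f i)) (hO : S.OSC)
    {F : Set (EuclideanSpace ℝ (Fin d))} (hF : MeasurableSet F)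
    (hFE : F ⊆ S.attractor) :
    S.natMeasure F = ∑ i, S.r i ^ S.hdim * S.natMeasure (S.attractor ∩ S.f i ⁻¹' F) := by
  obtain ⟨s, hs, hsum, h0, htop⟩ := hdim_spec hsurj hO
  have hE := isAttractor_attractor hO
  set E := S.attractor
  have hle {A : Set (EuclideanSpace ℝ (Fin d))} (hA : A ⊆ E) :
      μH[s] A ≤ ∑ i, μH[s] (S.f i '' E ∩ A) := by
    have hcover : A ⊆ ⋃ i, (S.f i '' E ∩ A) := by
      intro x hx
      have := hA hx
      rw [hE.2.2] at this
      obtain ⟨i, hi⟩ := Set.mem_iUnion.1 this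
      exact Set.mem_iUnion.2 ⟨i, hi, hx⟩
    exact (measure_mono hcover).trans (measure_iUnion_fintype_le _ _)
  have himg (i : S.ι) (A : Set (EuclideanSpace ℝ (Fin d))) :
      μH[s] (S.f i '' A) = ENNReal.ofReal (S.r i ^ (s : ℝ)) * μH[s] A := by
    have := hausdorffMeasure_word_image [i] s A
    rw [ratio_cons, ratio_nil, mul_one] at this
    exact this
  have htotal : ∑ i, μH[s] (S.f i '' E) = μH[s] E := by
    simp_rw [himg]
    rw [← Finset.sum_mul, ← ENNReal.ofReal_sum_of_nonneg
      fun i _ => (Real.rpow_pos_of_pos (S.r_pos i) _).le, hsum, ENNReal.ofReal_one, one_mul]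
  have heq : μH[s] F = ∑ i, μH[s] (S.f i '' E ∩ F) := by
    refine le_antisymm (hle hFE) ?_
    have hsplit (i : S.ι) : μH[s] (S.f i '' E) =
        μH[s] (S.f i '' E ∩ F) + μH[s] (S.f i '' E ∩ (E \ F)) := by
      rw [← measure_inter_add_sdiff (S.f i '' E) hF]
      congr 2
      rw [← Set.inter_sdiff_assoc, Set.inter_eq_left.2 (hE.image_subset i)]
    have hE' : μH[s] E = μH[s] F + μH[s] (E \ F) := by
      rw [← measure_inter_add_sdiff E hF, Set.inter_eq_right.2 hFE]
    have hfin : μH[s] (E \ F) ≠ ⊤ := ne_top_of_le_ne_top htop (measure_mono Set.sdiff_subset)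
    have : ∑ i, μH[s] (S.f i '' E ∩ F) + μH[s] (E \ F) ≤ μH[s] F + μH[s] (E \ F) := by
      rw [← hE', ← htotal]
      simp_rw [hsplit]
      rw [Finset.sum_add_distrib]
      gcongr
      exact hle Set.sdiff_subset
    exact (ENNReal.add_le_add_iff_right hfin).1 this
  have hterm (i : S.ι) : μH[s] (S.f i '' E ∩ F) =
      ENNReal.ofReal (S.r i ^ (s : ℝ)) * μH[s] (E ∩ S.f i ⁻¹' F) := by
    rw [← himg, Set.image_inter_preimage]
  simp_rw [natMeasure, hs]
  rw [heq, ENNReal.div_eq_inv_mul, Finset.mul_sum, ENNReal.toReal_sum]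
  · refine Finset.sum_congr rfl fun i _ => ?_
    rw [hterm, mul_left_comm, ENNReal.toReal_mul,
      ENNReal.toReal_ofReal (Real.rpow_pos_of_pos (S.r_pos i) _).le, ENNReal.div_eq_inv_mul]
  · intro i _
    exact ENNReal.mul_ne_top (ENNReal.inv_ne_top.2 h0)
      (ne_top_of_le_ne_top htop (measure_mono
        (Set.inter_subset_left.trans (hE.image_subset i))))

end NatMeasure

lemma natMeasure_empty : S.natMeasure ∅ = 0 := by simp [natMeasure]

/-! ### Relatively clopen subsets of the attractor -/

/-- `F` is a relatively clopen subset of the attractor. -/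
def IsSep (S : IFS d) (F : Set (EuclideanSpace ℝ (Fin d))) : Prop :=
  IsCompact F ∧ F ⊆ S.attractor ∧ IsCompact (S.attractor \ F)

lemma IsSep.inter {F G : Set (EuclideanSpace ℝ (Fin d))} (hF : S.IsSep F) (hG : S.IsSep G) :
    S.IsSep (F ∩ G) :=
  ⟨hF.1.inter hG.1, Set.inter_subset_left.trans hF.2.1, by
    rw [Set.sdiff_inter]; exact hF.2.2.union hG.2.2⟩

lemma IsSep.union {F G : Set (EuclideanSpace ℝ (Fin d))} (hF : S.IsSep F) (hG : S.IsSep G) :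
    S.IsSep (F ∪ G) :=
  ⟨hF.1.union hG.1, Set.union_subset hF.2.1 hG.2.1, by
    rw [← Set.sdiff_inter_sdiff]; exact hF.2.2.inter hG.2.2⟩

lemma IsSep.compl {F : Set (EuclideanSpace ℝ (Fin d))} (hF : S.IsSep F) :
    S.IsSep (S.attractor \ F) :=
  ⟨hF.2.2, Set.sdiff_subset, by rw [Set.sdiff_sdiff_cancel_left hF.2.1]; exact hF.1⟩

lemma IsSep.sdiff {F G : Set (EuclideanSpace ℝ (Fin d))} (hF : S.IsSep F) (hG : S.IsSep G) :
    S.IsSep (F \ G) := by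
  have : F \ G = F ∩ (S.attractor \ G) := by
    rw [← Set.inter_sdiff_assoc, Set.inter_eq_left.2 hF.2.1]
  rw [this]
  exact hF.inter hG.compl

/-- Deep cylinders are either contained in a given relatively clopen set or disjoint from it. -/
lemma IsSep.exists_level (hE : S.IsAttractor S.attractor)
    {F : Set (EuclideanSpace ℝ (Fin d))} (hF : S.IsSep F) :
    ∃ n, ∀ w : List S.ι, w.length = n →
      S.word w '' S.attractor ⊆ F ∨ Disjoint (S.word w '' S.attractor) F := by
  obtain ⟨δ, hδ, hdis⟩ := Disjoint.exists_thickenings Set.disjoint_sdiff_right hF.1 hF.2.2.isClosed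
  obtain ⟨n, hn⟩ := exists_ratio_mul_lt (S := S) (Metric.diam S.attractor) hδ
  refine ⟨n, fun w hw => ?_⟩
  by_contra! hcon
  obtain ⟨y, hy, hyF⟩ := Set.not_subset.1 hcon.1
  obtain ⟨x, hx, hxF⟩ := Set.not_disjoint_iff.1 hcon.2
  have hxy := (dist_le_of_mem_word_image hE.2.1.isBounded hx hy).trans_lt (hn w hw)
  have hyE : y ∈ S.attractor := by
    obtain ⟨z, hz, rfl⟩ := hy
    exact S.word_mem hE.image_subset w hz
  exact Set.disjoint_left.1 hdis (Metric.self_subset_thickening hδ _ hxF)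
    (Metric.mem_thickening_iff.2 ⟨y, ⟨hyE, hyF⟩, hxy⟩)

lemma exists_isSep (hE : S.IsAttractor S.attractor) (hT : IsTotallyDisconnected S.attractor)
    {U : Set (EuclideanSpace ℝ (Fin d))} (hU : IsOpen U) {x : EuclideanSpace ℝ (Fin d)}
    (hx : x ∈ S.attractor) (hxU : x ∈ U) : ∃ F, S.IsSep F ∧ x ∈ F ∧ F ⊆ U := by
  have : CompactSpace S.attractor := isCompact_iff_compactSpace.1 hE.2.1
  have : TotallyDisconnectedSpace S.attractor := totallyDisconnectedSpace_subtype_iff.2 hT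
  obtain ⟨V, hV, hxV, hVU⟩ := compact_exists_isClopen_in_isOpen
    (hU.preimage continuous_subtype_val) (show (⟨x, hx⟩ : S.attractor) ∈ Subtype.val ⁻¹' U from hxU)
  refine ⟨Subtype.val '' V, ⟨hV.1.isCompact.image continuous_subtype_val, by simp, ?_⟩,
    ⟨_, hxV, rfl⟩, by simpa using hVU⟩
  have : S.attractor \ Subtype.val '' V = Subtype.val '' Vᶜ := by
    rw [Set.image_compl_eq_range_sdiff_image Subtype.val_injective, Subtype.range_coe]
  rw [this]
  exact hV.compl.1.isCompact.image continuous_subtype_val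

/-! ### The ideal -/

section Ideal

variable {r : ℝ}

lemma IsRatioRoot.nonempty (hr : S.IsRatioRoot r) : Nonempty S.ι := by
  by_contra h
  rw [not_nonempty_iff] at h
  obtain ⟨-, -, lam, -, -, hgcd⟩ := hr
  simp at hgcd

lemma self_mem_Zring (p : ℝ) : p ∈ Zring p := Subring.subset_closure rfl

lemma IsRatioRoot.ratio_rpow_eq (hr : S.IsRatioRoot r) (w : List S.ι) :
    ∃ n : ℕ, S.ratio w ^ S.hdim = (r ^ S.hdim) ^ n := by
  obtain ⟨hr0, -, lam, -, hlam, -⟩ := hr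
  induction w with
  | nil => exact ⟨0, by simp⟩
  | cons i w ih =>
    obtain ⟨n, hn⟩ := ih
    refine ⟨lam i + n, ?_⟩
    rw [ratio_cons, Real.mul_rpow (S.r_pos i).le (S.ratio_pos w).le, hn, hlam, pow_add,
      Real.rpow_pow_comm hr0.le S.hdim (lam i)]

lemma IsRatioRoot.ratio_rpow_mem (hr : S.IsRatioRoot r) (w : List S.ι) :
    S.ratio w ^ S.hdim ∈ Zring (r ^ S.hdim) := by
  obtain ⟨n, hn⟩ := hr.ratio_rpow_eq w
  rw [hn]
  exact pow_mem (self_mem_Zring _) n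

lemma IsRatioRoot.inv_ratio_rpow_mem (hr : S.IsRatioRoot r)
    (hsum : ∑ i, S.r i ^ S.hdim = 1) (w : List S.ι) :
    (S.ratio w ^ S.hdim)⁻¹ ∈ Zring (r ^ S.hdim) := by
  have hinv : (r ^ S.hdim)⁻¹ ∈ Zring (r ^ S.hdim) := by
    obtain ⟨hr0, -, lam, hpos, hlam, -⟩ := hr
    have hp : r ^ S.hdim ≠ 0 := (Real.rpow_pos_of_pos hr0 _).ne'
    have : (r ^ S.hdim)⁻¹ = ∑ i, (r ^ S.hdim) ^ (lam i - 1) := by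
      rw [← mul_left_inj' hp, inv_mul_cancel₀ hp, Finset.sum_mul, ← hsum]
      refine Finset.sum_congr rfl fun i _ => ?_
      rw [pow_sub_one_mul (hpos i).ne', hlam, Real.rpow_pow_comm hr0.le]
    rw [this]
    exact sum_mem fun i _ => pow_mem (self_mem_Zring _) _
  obtain ⟨n, hn⟩ := hr.ratio_rpow_eq w
  rw [hn, ← inv_pow]
  exact pow_mem hinv n

/-- The natural measure of a relatively clopen set lies in `ℤ[p]`. -/
lemma IsSep.natMeasure_mem (hr : S.IsRatioRoot r) (hsurj : ∀ i, Function.Surjective (S.f i))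
    (hO : S.OSC) {F : Set (EuclideanSpace ℝ (Fin d))} (hF : S.IsSep F) :
    S.natMeasure F ∈ Zring (r ^ S.hdim) := by
  have := hr.nonempty
  have hE := isAttractor_attractor hO
  obtain ⟨n, hn⟩ := hF.exists_level hE
  obtain ⟨hFc, hFE, -⟩ := hF
  induction n generalizing F with
  | zero =>
    have himg : S.word [] '' S.attractor = S.attractor := Set.image_id _
    rcases hn [] rfl with h | h <;> rw [himg] at h
    · rw [h.antisymm' hFE, natMeasure_attractor hsurj hO]
      exact one_mem _
    · rw [h.symm.eq_bot_of_le hFE, Set.bot_eq_empty, natMeasure_empty]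
      exact zero_mem _
  | succ n ih =>
    rw [natMeasure_eq_sum hsurj hO hFc.measurableSet hFE]
    refine sum_mem fun i _ => mul_mem (by simpa using hr.ratio_rpow_mem [i]) ?_
    refine ih (fun w hw => ?_)
      (hE.2.1.inter_right (hFc.isClosed.preimage (S.continuous_word [i]))) Set.inter_subset_left
    rcases hn (i :: w) (by simp [hw]) with h | h
    · refine Or.inl ?_
      rintro _ ⟨x, hx, rfl⟩
      exact ⟨S.word_mem hE.image_subset w hx, h ⟨x, hx, rfl⟩⟩
    · refine Or.inr (Set.disjoint_left.2 ?_)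
      rintro _ ⟨x, hx, rfl⟩ hx'
      exact Set.disjoint_left.1 h ⟨x, hx, rfl⟩ hx'.2

lemma add_mem_idealSet {R : Subring ℝ} {I : Ideal R} {x y : ℝ} (hx : x ∈ idealSet I)
    (hy : y ∈ idealSet I) : x + y ∈ idealSet I := by
  obtain ⟨a, ha, rfl⟩ := hx
  obtain ⟨b, hb, rfl⟩ := hy
  exact ⟨a + b, I.add_mem ha hb, rfl⟩

lemma mul_mem_idealSet {R : Subring ℝ} {I : Ideal R} {x y : ℝ} (hx : x ∈ R)
    (hy : y ∈ idealSet I) : x * y ∈ idealSet I := by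
  obtain ⟨b, hb, rfl⟩ := hy
  exact ⟨⟨x, hx⟩ * b, I.mul_mem_left _ hb, rfl⟩

/-- Each point of the attractor has a relatively clopen neighbourhood all of whose relatively
clopen subsets have a copy which is an interior separated set. -/
lemma exists_isSep_forall_isIntSep (hO : S.OSC) (hT : IsTotallyDisconnected S.attractor)
    (hE : S.IsAttractor S.attractor) (hH : S.OrthHomog) (hC : S.COSC)
    {x : EuclideanSpace ℝ (Fin d)} (hx : x ∈ S.attractor) :
    ∃ C, S.IsSep C ∧ x ∈ C ∧ ∃ w : List S.ι, ∀ F ⊆ C, S.IsSep F → S.IsIntSep (S.word w '' F) := by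
  obtain ⟨O₁, hO₁, z, hzE, hzO⟩ := hE.exists_oscSet_inter_nonempty hH.surjective hO
  obtain ⟨D, hD, hzD, hDO⟩ := exists_isSep hE hT hO₁.2.1 hzE hzO
  obtain ⟨n, hn⟩ := hD.exists_level hE
  obtain ⟨O, hOSC, hconv⟩ := hC
  let W : Set (List S.ι) := {w | w.length = n ∧ ¬ Disjoint (S.word w '' S.attractor) D}
  have hW : W.Finite := (List.finite_length_eq S.ι n).subset fun w hw => hw.1
  have hWne : W.Nonempty := by
    obtain ⟨w, hw, hzw⟩ := hE.exists_word n hzE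
    exact ⟨w, hw, Set.not_disjoint_iff.2 ⟨z, hzw, hzD⟩⟩
  obtain ⟨w, hwW, hw⟩ := hOSC.exists_untouched hconv hH hW hWne (fun w hw => hw.1) x
  have hwD : S.word w '' S.attractor ⊆ D := (hn w hwW.1).resolve_right hwW.2
  set T : Set (EuclideanSpace ℝ (Fin d)) :=
    ⋃ v ∈ {v : List S.ι | v.length = n ∧ v ≠ w}, S.word v '' S.attractor
  have hTc : IsCompact T :=
    ((List.finite_length_eq S.ι n).subset fun v hv => hv.1).isCompact_biUnion
      fun v _ => hE.2.1.image (S.continuous_word v)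
  have hxT : S.word w x ∉ T := by
    intro hxT
    obtain ⟨v, ⟨hvn, hvw⟩, hxv⟩ := Set.mem_iUnion₂.1 hxT
    by_cases hv : v ∈ W
    · exact hw v hv hvw (Set.image_mono (hE.subset_closure_oscSet hOSC) hxv)
    · refine hv ⟨hvn, Set.not_disjoint_iff.2 ⟨_, hxv, hwD ⟨x, hx, rfl⟩⟩⟩
  obtain ⟨C, hC, hxC, hCT⟩ := exists_isSep hE hT
    (hTc.isClosed.isOpen_compl.preimage (S.continuous_word w)) hx hxT
  refine ⟨C, hC, hxC, w, fun F hFC hF => ⟨hF.1.image (S.continuous_word w), ?_, ?_, O₁, hO₁, ?_⟩⟩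
  · rintro _ ⟨y, hy, rfl⟩
    exact S.word_mem hE.image_subset w (hF.2.1 hy)
  · have : S.attractor \ S.word w '' F = T ∪ S.word w '' (S.attractor \ F) := by
      refine Set.Subset.antisymm ?_ (Set.union_subset ?_ ?_)
      · rintro y ⟨hyE, hyF⟩
        obtain ⟨v, hv, hyv⟩ := hE.exists_word n hyE
        by_cases hvw : v = w
        · subst hvw
          obtain ⟨y, hy, rfl⟩ := hyv
          exact Or.inr ⟨y, ⟨hy, fun h => hyF ⟨y, h, rfl⟩⟩, rfl⟩
        · exact Or.inl (Set.mem_iUnion₂.2 ⟨v, ⟨hv, hvw⟩, hyv⟩)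
      · intro y hy
        refine ⟨?_, ?_⟩
        · obtain ⟨v, -, u, hu, rfl⟩ := Set.mem_iUnion₂.1 hy
          exact S.word_mem hE.image_subset v hu
        · rintro ⟨u, hu, rfl⟩
          exact hCT (hFC hu) hy
      · rintro _ ⟨y, ⟨hyE, hyF⟩, rfl⟩
        refine ⟨S.word_mem hE.image_subset w hyE, ?_⟩
        rintro ⟨u, hu, huy⟩
        exact hyF (S.word_injective w huy ▸ hu)
    rw [this]
    exact hTc.union (hF.2.2.image (S.continuous_word w))
  · exact (Set.image_mono hF.2.1).trans (hwD.trans hDO)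

theorem one_mem_idealSet (hr : S.IsRatioRoot r) (hO : S.OSC)
    (hT : IsTotallyDisconnected S.attractor) (hH : S.OrthHomog) (hC : S.COSC) :
    (1 : ℝ) ∈ idealSet (S.idealOf (r ^ S.hdim)) := by
  have := hr.nonempty
  have hsurj := hH.surjective
  have hE := isAttractor_attractor hO
  set I := idealSet (S.idealOf (r ^ S.hdim)) with hI
  have hind : ∃ C, S.IsSep C ∧ S.attractor ⊆ C ∧ ∀ F ⊆ C, S.IsSep F → S.natMeasure F ∈ I := by
    refine hE.2.1.induction_on (p := fun A => ∃ C, S.IsSep C ∧ A ⊆ C ∧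
      ∀ F ⊆ C, S.IsSep F → S.natMeasure F ∈ I) ?_ ?_ ?_ ?_
    · refine ⟨∅, ⟨isCompact_empty, Set.empty_subset _, by simpa using hE.2.1⟩, le_rfl,
        fun F hF _ => ?_⟩
      rw [Set.subset_empty_iff.1 hF, natMeasure_empty]
      exact ⟨0, Ideal.zero_mem _, rfl⟩
    · rintro A B hAB ⟨C, hC, hBC, h⟩
      exact ⟨C, hC, hAB.trans hBC, h⟩
    · rintro A B ⟨C, hC, hAC, h⟩ ⟨C', hC', hBC', h'⟩
      refine ⟨C ∪ C', hC.union hC', Set.union_subset_union hAC hBC', fun F hFC hF => ?_⟩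
      rw [← Set.inter_union_sdiff F C, natMeasure_union hsurj hO
        (Set.disjoint_sdiff_right.mono_left Set.inter_subset_right)
        (hF.sdiff hC).1.measurableSet (hF.inter hC).2.1 (hF.sdiff hC).2.1]
      refine add_mem_idealSet (h _ Set.inter_subset_right (hF.inter hC)) (h' _ ?_ (hF.sdiff hC))
      rintro y ⟨hyF, hyC⟩
      exact (hFC hyF).resolve_left hyC
    · intro x hx
      obtain ⟨C, hCs, hxC, w, hw⟩ := exists_isSep_forall_isIntSep hO hT hE hH hC hx
      refine ⟨C, ?_, C, hCs, le_rfl, fun F hFC hF => ?_⟩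
      · rw [mem_nhdsWithin]
        refine ⟨(S.attractor \ C)ᶜ, hCs.2.2.isClosed.isOpen_compl, fun h => h.2 hxC, ?_⟩
        rintro y ⟨hy, hyE⟩
        by_contra hyC
        exact hy ⟨hyE, hyC⟩
      · have hpos : S.ratio w ^ S.hdim ≠ 0 := (Real.rpow_pos_of_pos (S.ratio_pos w) _).ne'
        have hmul := natMeasure_word_image hsurj hO w F
        have hmem : S.natMeasure (S.word w '' F) ∈ I := by
          have hZ : S.natMeasure (S.word w '' F) ∈ Zring (r ^ S.hdim) := by
            rw [hmul]
            exact mul_mem (hr.ratio_rpow_mem w) (hF.natMeasure_mem hr hsurj hO)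
          exact ⟨⟨_, hZ⟩, Ideal.subset_span ⟨_, hw F hFC hF, rfl⟩, rfl⟩
        rw [← inv_mul_cancel_left₀ hpos (S.natMeasure F), ← hmul]
        exact mul_mem_idealSet (hr.inv_ratio_rpow_mem (sum_r_rpow_hdim hsurj hO) w) hmem
  obtain ⟨C, hCs, hEC, h⟩ := hind
  rw [← natMeasure_attractor hsurj hO]
  exact h _ hEC ⟨hE.2.1, le_rfl, by simp⟩

end Ideal

end IFS

/-- **Theorem.** If `S ∈ TOEC` is orthogonally homogeneous and satisfies the convex
open set condition, then `I_S = ℤ[p_S]`; in particular `I_S` is a principal ideal. -/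
theorem idealOf_eq_top_of_orthHomog_of_COSC {d : ℕ} (S : IFS d) (hS : S.MemTOEC)
    (r : ℝ) (hr : S.IsRatioRoot r) (hOH : S.OrthHomog) (hC : S.COSC) :
    S.idealOf (r ^ S.hdim) = ⊤ ∧ (S.idealOf (r ^ S.hdim)).IsPrincipal := by
  have htop : S.idealOf (r ^ S.hdim) = ⊤ := by
    obtain ⟨x, hx, hx1⟩ := IFS.one_mem_idealSet hr hS.1 hS.2.2 hOH hC
    rw [Ideal.eq_top_iff_one, ← (Subtype.ext hx1 : x = 1)]
    exact hx
  refine ⟨htop, ?_⟩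
  rw [htop]
  infer_instance

end
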